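/- arXiv:hep-th/0204097 — 4 statements merged into one kernel-verified Lean document; each statement's English description precedes it below -/
import Mathlib

section
/- Let n ≥ 1 and let p be a p-function that is symmetric under simultaneous exchange of rapidities and indices, i.e. for every permutation σ of {1,…,n} one has p((θ_{σ(1)},…,θ_{σ(n)}), (l_{σ(1)},…,l_{σ(n)})) = p((θ_1,…,θ_n),(l_1,…,l_n)) for all θ ∈ ℂ^n and l ∈ {0,1}^n. Then the K-function is a symmetric function of the rapidities: for every permutation σ and every admissible θ, K_n[p](θ_{σ(1)},…,θ_{σ(n)}) = K_n[p](θ_1,…,θ_n). -/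
open Finset

/-- The K-function `K_n[p](θ)` from the paper (eq. (1.2)):
`K_n[p](θ) = Σ_{l ∈ {0,1}^n} (−1)^{l_1+…+l_n} Π_{i<j} (1 + (l_i − l_j)·i·sin(πν)/sinh(θ_i − θ_j)) · p(θ,l)`. -/
noncomputable def Kfun (ν : ℝ) {n : ℕ} (p : (Fin n → ℂ) → (Fin n → Fin 2) → ℂ)
    (θ : Fin n → ℂ) : ℂ :=
  ∑ l : Fin n → Fin 2,
    (-1 : ℂ) ^ (∑ i, (l i : ℕ)) *
    (∏ i : Fin n, ∏ j : Fin n,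
      if (i : ℕ) < (j : ℕ) then
        1 + (((l i : ℕ) : ℂ) - ((l j : ℕ) : ℂ)) * Complex.I *
          (Real.sin (Real.pi * ν) : ℂ) / Complex.sinh (θ i - θ j)
      else 1) *
    p θ l

/-- `θ` is admissible if `sinh(θ_i − θ_j) ≠ 0` for all `i < j`. -/
def Admissible {n : ℕ} (θ : Fin n → ℂ) : Prop :=
  ∀ i j : Fin n, i < j → Complex.sinh (θ i - θ j) ≠ 0

/-- A product over ordered pairs `i < j` of a symmetric function is invariant under relabelling. -/
theorem prod_prod_lt_comp_perm {ι M : Type*} [Fintype ι] [LinearOrder ι] [CommMonoid M]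
    (f : ι → ι → M) (hf : ∀ i j, f i j = f j i) (σ : Equiv.Perm ι) :
    (∏ i, ∏ j, if i < j then f (σ i) (σ j) else 1) = ∏ i, ∏ j, if i < j then f i j else 1 := by
  rw [← Fintype.prod_prod_type', ← Fintype.prod_prod_type', ← prod_filter, ← prod_filter]
  refine prod_nbij' (fun x ↦ (min (σ x.1) (σ x.2), max (σ x.1) (σ x.2)))
    (fun x ↦ (min (σ.symm x.1) (σ.symm x.2), max (σ.symm x.1) (σ.symm x.2))) ?_ ?_ ?_ ?_ ?_
  · rintro ⟨i, j⟩ h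
    simpa using (mem_filter.1 h).2.ne'
  · rintro ⟨i, j⟩ h
    simpa using (mem_filter.1 h).2.ne'
  · rintro ⟨i, j⟩ h
    have hij : i < j := (mem_filter.1 h).2
    rcases le_total (σ i) (σ j) with h' | h' <;> simp [h', hij.le]
  · rintro ⟨i, j⟩ h
    have hij : i < j := (mem_filter.1 h).2
    rcases le_total (σ.symm i) (σ.symm j) with h' | h' <;> simp [h', hij.le]
  · rintro ⟨i, j⟩ -
    rcases le_total (σ i) (σ j) with h' | h' <;> simp [h', hf (σ i) (σ j)]

/-- if the p-function is symmetric under simultaneous exchange of the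
rapidities and the indices, then the K-function is a symmetric function of the rapidities. -/
theorem Kfun_symmetric (ν : ℝ) (n : ℕ) (hn : 1 ≤ n)
    (p : (Fin n → ℂ) → (Fin n → Fin 2) → ℂ)
    (hp : ∀ σ : Equiv.Perm (Fin n), ∀ θ : Fin n → ℂ, ∀ l : Fin n → Fin 2,
      p (θ ∘ σ) (l ∘ σ) = p θ l)
    (σ : Equiv.Perm (Fin n)) (θ : Fin n → ℂ) (hθ : Admissible θ) :
    Kfun ν p (θ ∘ σ) = Kfun ν p θ := by
  unfold Kfun
  symm
  refine Fintype.sum_equiv (σ.symm.arrowCongr (Equiv.refl _)) _ _ fun l ↦ ?_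
  have hl : σ.symm.arrowCongr (Equiv.refl _) l = l ∘ σ := rfl
  rw [hl, hp]
  simp only [Function.comp_apply, Fin.val_fin_lt]
  rw [Equiv.sum_comp σ fun i ↦ (l i : ℕ)]
  congr 2
  refine (prod_prod_lt_comp_perm (fun i j ↦ 1 + (((l i : ℕ) : ℂ) - ((l j : ℕ) : ℂ)) * Complex.I *
    (Real.sin (Real.pi * ν) : ℂ) / Complex.sinh (θ i - θ j)) (fun i j ↦ ?_) σ).symm
  rw [← neg_sub (θ j) (θ i), Complex.sinh_neg, div_neg, ← neg_div]
  ring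
end

section
/- (Lemma 1 of the paper.) Let n ≥ 1 and suppose the p-function does not depend on l, i.e. p(θ, l) = c(θ) for some function c of the rapidities alone. Then K_n[p](θ) = 0 for every admissible θ. Equivalently, for every ν ∈ ℝ and every admissible θ, Σ_{l ∈ {0,1}^n} (−1)^{l_1 + … + l_n} · Π_{1 ≤ i < j ≤ n} (1 + (l_i − l_j)·i·sin(πν)/sinh(θ_i − θ_j)) = 0. -/
open Finset

/-- The signed sum over all `S ⊆ V` of `∏ (1 + g i j)` over the pairs `i ∈ S`, `j ∈ V \ S`. -/
def signedCutSum {ι R : Type*} [DecidableEq ι] [CommRing R] (g : ι → ι → R) (V : Finset ι) : R :=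
  ∑ S ∈ V.powerset, (-1) ^ #S * ∏ i ∈ S, ∏ j ∈ V \ S, (1 + g i j)

section CutWeight

variable {ι R : Type*} [DecidableEq ι] [CommRing R] (g : ι → ι → R) {a : ι} {U T : Finset ι}

theorem prod_cut_insert_of_notMem (ha : a ∉ U) (hT : T ⊆ U) :
    ∏ i ∈ T, ∏ j ∈ insert a U \ T, (1 + g i j) =
      (∏ i ∈ T, (1 + g i a)) * ∏ i ∈ T, ∏ j ∈ U \ T, (1 + g i j) := by
  rw [insert_sdiff_of_notMem _ (fun h => ha (hT h)), ← prod_mul_distrib]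
  exact prod_congr rfl fun i _ => prod_insert fun h => ha (mem_sdiff.1 h).1

theorem prod_cut_insert_insert (ha : a ∉ U) (hT : T ⊆ U) :
    ∏ i ∈ insert a T, ∏ j ∈ insert a U \ insert a T, (1 + g i j) =
      (∏ j ∈ U \ T, (1 + g a j)) * ∏ i ∈ T, ∏ j ∈ U \ T, (1 + g i j) := by
  have h : insert a U \ insert a T = U \ T := by
    ext x
    simp only [mem_sdiff, mem_insert]
    grind
  rw [h, prod_insert fun h => ha (hT h)]

theorem sum_powerset_insert_cut (ha : a ∉ U) (f : Finset ι → R) :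
    ∑ S ∈ (insert a U).powerset,
        (-1) ^ #S * (∏ i ∈ S, ∏ j ∈ insert a U \ S, (1 + g i j)) * f S =
      ∑ T ∈ U.powerset, (-1) ^ #T * (∏ i ∈ T, ∏ j ∈ U \ T, (1 + g i j)) *
        ((∏ i ∈ T, (1 + g i a)) * f T - (∏ j ∈ U \ T, (1 + g a j)) * f (insert a T)) := by
  rw [sum_powerset_insert ha, ← sum_add_distrib]
  refine sum_congr rfl fun T hT => ?_
  have hT := mem_powerset.1 hT
  rw [prod_cut_insert_of_notMem g ha hT, prod_cut_insert_insert g ha hT,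
    card_insert_of_notMem fun h => ha (hT h)]
  ring

theorem signedCutSum_insert (ha : a ∉ U) :
    signedCutSum g (insert a U) =
      ∑ T ∈ U.powerset, (-1) ^ #T * (∏ i ∈ T, ∏ j ∈ U \ T, (1 + g i j)) *
        ((∏ i ∈ T, (1 + g i a)) - ∏ j ∈ U \ T, (1 + g a j)) := by
  simpa [signedCutSum] using sum_powerset_insert_cut g ha fun _ => 1

end CutWeight

section Interpolation

open Polynomial

variable {ι K : Type*} [Field K] (c : K) (y : ι → K)

/-- In the variables `y i = exp (θ i)`, this is `(c / 2) / sinh (θ i - θ j)`. -/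
def sinhKernel (i j : ι) : K := c * y i * y j / (y i ^ 2 - y j ^ 2)

theorem prod_sub_eq_mul_prod_one_add_sinhKernel {S : Finset ι} {a : ι}
    (h : ∀ k ∈ S, y a ^ 2 - y k ^ 2 ≠ 0) :
    ∏ k ∈ S, (y a ^ 2 - y k ^ 2 - c * y a * y k) =
      (∏ k ∈ S, (y a ^ 2 - y k ^ 2)) * ∏ k ∈ S, (1 + sinhKernel c y k a) := by
  rw [← prod_mul_distrib]
  refine prod_congr rfl fun k hk => ?_
  have h' : y k ^ 2 - y a ^ 2 ≠ 0 := by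
    rw [← neg_sub]
    exact neg_ne_zero.2 (h k hk)
  rw [sinhKernel]
  field_simp
  ring

theorem prod_add_eq_mul_prod_one_add_sinhKernel {S : Finset ι} {a : ι}
    (h : ∀ k ∈ S, y a ^ 2 - y k ^ 2 ≠ 0) :
    ∏ k ∈ S, (y a ^ 2 - y k ^ 2 + c * y a * y k) =
      (∏ k ∈ S, (y a ^ 2 - y k ^ 2)) * ∏ k ∈ S, (1 + sinhKernel c y a k) := by
  rw [← prod_mul_distrib]
  refine prod_congr rfl fun k hk => ?_
  have := h k hk
  rw [sinhKernel]
  field_simp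

variable [DecidableEq ι]

/-- The product of `x ^ 2 - y k ^ 2` over `k ∈ U`, times the difference of cut weights obtained by
putting a new vertex with variable `x` outside, respectively inside, the subset `T` of `U`. -/
def clearedDiff {A : Type*} [CommRing A] (c : A) (y : ι → A) (U T : Finset ι) (x : A) : A :=
  (∏ k ∈ T, (x ^ 2 - y k ^ 2 - c * x * y k)) * (∏ k ∈ U \ T, (x ^ 2 - y k ^ 2)) -
    (∏ k ∈ U \ T, (x ^ 2 - y k ^ 2 + c * x * y k)) * ∏ k ∈ T, (x ^ 2 - y k ^ 2)

theorem degree_clearedDiff_lt {U T : Finset ι} (hT : T ⊆ U) :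
    (clearedDiff (C c) (fun k => C (y k)) U T X).degree < ((2 * #U : ℕ) : WithBot ℕ) := by
  have hquad (p : K[X]) (b d : K) (h : p = X ^ 2 + (C b * X + C d)) :
      p.Monic ∧ p.natDegree = 2 := by
    subst h
    have h : (C b * X + C d).degree < ((2 : ℕ) : WithBot ℕ) :=
      degree_linear_le.trans_lt (by norm_num)
    refine ⟨monic_X_pow_add h, ?_⟩
    rw [natDegree_add_eq_left_of_degree_lt (by rwa [degree_X_pow]), natDegree_X_pow]
  have hminus (k : ι) := hquad (X ^ 2 - C (y k) ^ 2 - C c * X * C (y k))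
    (-(c * y k)) (-(y k ^ 2)) (by simp; ring)
  have hzero (k : ι) := hquad (X ^ 2 - C (y k) ^ 2) 0 (-(y k ^ 2)) (by simp; ring)
  have hplus (k : ι) := hquad (X ^ 2 - C (y k) ^ 2 + C c * X * C (y k))
    (c * y k) (-(y k ^ 2)) (by simp; ring)
  have hprod (S S' : Finset ι) (p q : ι → K[X]) (hS : #S + #S' = #U)
      (hp : ∀ k, (p k).Monic ∧ (p k).natDegree = 2)
      (hq : ∀ k, (q k).Monic ∧ (q k).natDegree = 2) :
      ((∏ k ∈ S, p k) * ∏ k ∈ S', q k).Monic ∧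
        ((∏ k ∈ S, p k) * ∏ k ∈ S', q k).degree = ((2 * #U : ℕ) : WithBot ℕ) := by
    have h1 := monic_prod_of_monic S p fun k _ => (hp k).1
    have h2 := monic_prod_of_monic S' q fun k _ => (hq k).1
    refine ⟨h1.mul h2, ?_⟩
    rw [degree_eq_natDegree (h1.mul h2).ne_zero, h1.natDegree_mul h2,
      natDegree_prod_of_monic _ _ fun k _ => (hp k).1,
      natDegree_prod_of_monic _ _ fun k _ => (hq k).1]
    simp only [hp, hq, sum_const, smul_eq_mul, ← hS]
    congr 1
    ring
  have hc := card_sdiff_add_card_eq_card hT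
  obtain ⟨m1, d1⟩ := hprod T (U \ T) _ _ (by omega) hminus hzero
  obtain ⟨m2, d2⟩ := hprod (U \ T) T _ _ (by omega) hplus hzero
  rw [clearedDiff, ← d1]
  exact degree_sub_lt_left (d1.trans d2.symm) m1.ne_zero
    (m1.leadingCoeff.trans m2.leadingCoeff.symm)

theorem eval_clearedDiff (U T : Finset ι) (x : K) :
    (clearedDiff (C c) (fun k => C (y k)) U T X).eval x = clearedDiff c y U T x := by
  simp [clearedDiff, eval_prod]

theorem clearedDiff_eq_mul {U T : Finset ι} (hT : T ⊆ U) {a : ι}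
    (h : ∀ k ∈ U, y a ^ 2 - y k ^ 2 ≠ 0) :
    clearedDiff c y U T (y a) = (∏ k ∈ U, (y a ^ 2 - y k ^ 2)) *
      ((∏ i ∈ T, (1 + sinhKernel c y i a)) - ∏ j ∈ U \ T, (1 + sinhKernel c y a j)) := by
  rw [clearedDiff, prod_sub_eq_mul_prod_one_add_sinhKernel c y fun k hk => h k (hT hk),
    prod_add_eq_mul_prod_one_add_sinhKernel c y fun k hk => h k (mem_sdiff.1 hk).1,
    ← prod_sdiff hT]
  ring

variable {c y}

theorem sum_mul_clearedDiff_eq_zero {U : Finset ι} {j : ι} (hj : j ∉ U)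
    (h : ∀ k ∈ U, y j ^ 2 - y k ^ 2 ≠ 0)
    (ih : U.Nonempty → signedCutSum (sinhKernel c y) U = 0) {x : K} (hx : x = y j ∨ x = -y j) :
    ∑ S ∈ (insert j U).powerset, (-1) ^ #S *
      (∏ i ∈ S, ∏ k ∈ insert j U \ S, (1 + sinhKernel c y i k)) *
        clearedDiff c y (insert j U) S x = 0 := by
  rw [sum_powerset_insert_cut _ hj]
  have hx2 : x ^ 2 = y j ^ 2 := by rcases hx with rfl | rfl <;> ring
  have key : ∀ T ∈ U.powerset,
      (∏ i ∈ T, (1 + sinhKernel c y i j)) * clearedDiff c y (insert j U) T x -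
        (∏ k ∈ U \ T, (1 + sinhKernel c y j k)) * clearedDiff c y (insert j U) (insert j T) x =
      -(c * x * y j) * (
        (∏ k ∈ T, (y j ^ 2 - y k ^ 2 - c * y j * y k)) *
          (∏ k ∈ U \ T, (y j ^ 2 - y k ^ 2 + c * x * y k)) -
        (∏ k ∈ U \ T, (y j ^ 2 - y k ^ 2 + c * y j * y k)) *
          ∏ k ∈ T, (y j ^ 2 - y k ^ 2 - c * x * y k)) := by
    intro T hT
    have hT := mem_powerset.1 hT
    have hjT : j ∉ T := fun h => hj (hT h)
    have hjUT : j ∉ U \ T := fun h => hj (mem_sdiff.1 h).1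
    have hs : insert j U \ insert j T = U \ T := by
      ext x
      simp only [mem_sdiff, mem_insert]
      grind
    rw [prod_sub_eq_mul_prod_one_add_sinhKernel c y fun k hk => h k (hT hk),
      prod_add_eq_mul_prod_one_add_sinhKernel c y fun k hk => h k (mem_sdiff.1 hk).1,
      clearedDiff, clearedDiff, hs, insert_sdiff_of_notMem _ hjT, prod_insert hjUT,
      prod_insert hjUT, prod_insert hjT, prod_insert hjT, hx2]
    ring
  rw [sum_congr rfl fun T hT => by rw [key T hT]]
  rcases hx with rfl | rfl
  · refine sum_eq_zero fun T _ => ?_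
    ring
  · have hconst : ∀ T ∈ U.powerset,
        (∏ k ∈ T, (y j ^ 2 - y k ^ 2 - c * y j * y k)) *
          (∏ k ∈ U \ T, (y j ^ 2 - y k ^ 2 + c * -y j * y k)) -
        (∏ k ∈ U \ T, (y j ^ 2 - y k ^ 2 + c * y j * y k)) *
          (∏ k ∈ T, (y j ^ 2 - y k ^ 2 - c * -y j * y k)) =
        (∏ k ∈ U, (y j ^ 2 - y k ^ 2 - c * y j * y k)) -
          ∏ k ∈ U, (y j ^ 2 - y k ^ 2 + c * y j * y k) := by
      intro T hT
      simp only [mul_neg, neg_mul, sub_neg_eq_add, ← sub_eq_add_neg]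
      rw [prod_sdiff (mem_powerset.1 hT), mul_comm, prod_sdiff (mem_powerset.1 hT)]
    rw [sum_congr rfl fun T hT => by rw [hconst T hT], ← sum_mul]
    rcases U.eq_empty_or_nonempty with rfl | hU
    · simp
    · have := ih hU
      rw [signedCutSum] at this
      rw [this, zero_mul]

theorem signedCutSum_sinhKernel_eq_zero {V : Finset ι} (hV : V.Nonempty)
    (hinj : Set.InjOn y V) (hadd : ∀ i ∈ V, ∀ j ∈ V, y i + y j ≠ 0) :
    signedCutSum (sinhKernel c y) V = 0 := by
  induction V using Finset.strongInduction with
  | H V ih =>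
  have hsq : ∀ i ∈ V, ∀ j ∈ V, i ≠ j → y i ^ 2 - y j ^ 2 ≠ 0 := fun i hi j hj hij => by
    rw [sq_sub_sq]
    exact mul_ne_zero (hadd i hi j hj) (sub_ne_zero.2 fun h => hij (hinj hi hj h))
  obtain ⟨a, haV⟩ := hV
  obtain ⟨U, haU, rfl⟩ : ∃ U, a ∉ U ∧ insert a U = V :=
    ⟨V.erase a, notMem_erase a V, insert_erase haV⟩
  have hP : ∑ T ∈ U.powerset, C ((-1) ^ #T * ∏ i ∈ T, ∏ j ∈ U \ T, (1 + sinhKernel c y i j)) *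
      clearedDiff (C c) (fun k => C (y k)) U T X = 0 := by
    refine eq_zero_of_degree_lt_of_eval_index_eq_zero (s := U ×ˢ (univ : Finset Bool))
      (v := fun p : ι × Bool => if p.2 then y p.1 else -y p.1) ?_ ?_ ?_
    · rintro ⟨i, s⟩ hi ⟨j, t⟩ hj hij
      replace hi : i ∈ insert a U := mem_insert_of_mem (by simpa using hi)
      replace hj : j ∈ insert a U := mem_insert_of_mem (by simpa using hj)
      have := hadd i hi j hj
      cases s <;> cases t <;> simp at hij ⊢
      · exact hinj hi hj hij
      · exact this (by rw [← hij]; ring)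
      · exact this (by rw [hij]; ring)
      · exact hinj hi hj hij
    · rw [card_product, card_univ, Fintype.card_bool, mul_comm]
      refine (degree_sum_le _ _).trans_lt ((Finset.sup_lt_iff (WithBot.bot_lt_coe _)).2 ?_)
      intro T hT
      refine lt_of_le_of_lt ?_ (degree_clearedDiff_lt c y (mem_powerset.1 hT))
      rw [← smul_eq_C_mul]
      exact degree_smul_le _ _
    · rintro ⟨j, s⟩ hj
      have hj : j ∈ U := by simpa using hj
      obtain ⟨U', hjU', rfl⟩ : ∃ U', j ∉ U' ∧ insert j U' = U :=
        ⟨U.erase j, notMem_erase j U, insert_erase hj⟩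
      simp only [eval_finsetSum, eval_mul, eval_C, eval_clearedDiff]
      have hsub : U' ⊆ insert a (insert j U') :=
        (subset_insert _ _).trans (subset_insert _ _)
      refine sum_mul_clearedDiff_eq_zero hjU' (fun k hk => ?_) (fun hne => ?_) ?_
      · exact hsq j (by simp) k (hsub hk) fun h => hjU' (h ▸ hk)
      · refine ih U' ((ssubset_iff_of_subset hsub).2 ⟨j, by simp, hjU'⟩) hne
          (hinj.mono (coe_subset.2 hsub)) fun i hi k hk => hadd i (hsub hi) k (hsub hk)
      · cases s <;> simp
  have hne : ∀ k ∈ U, y a ^ 2 - y k ^ 2 ≠ 0 := fun k hk =>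
    hsq a haV k (mem_insert_of_mem hk) fun h => haU (h ▸ hk)
  have hev := congrArg (eval (y a)) hP
  simp only [eval_finsetSum, eval_mul, eval_C, eval_clearedDiff, eval_zero] at hev
  rw [sum_congr rfl fun T hT => by
    rw [clearedDiff_eq_mul c y (mem_powerset.1 hT) hne, mul_left_comm], ← mul_sum,
    ← signedCutSum_insert _ haU] at hev
  exact (mul_eq_zero.1 hev).resolve_left (prod_ne_zero_iff.2 hne)

end Interpolation

theorem prod_prod_eq_prod_prod_lt {ι M : Type*} [Fintype ι] [LinearOrder ι] [CommMonoid M]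
    (f : ι → ι → M) (hf : ∀ i, f i i = 1) :
    ∏ i, ∏ j, f i j = ∏ i, ∏ j, if i < j then f i j * f j i else 1 := by
  have h1 : ∏ i, ∏ j, f i j =
      (∏ i, ∏ j, if i < j then f i j else 1) * ∏ i, ∏ j, if j < i then f i j else 1 := by
    simp only [← prod_mul_distrib]
    refine prod_congr rfl fun i _ => prod_congr rfl fun j _ => ?_
    rcases lt_trichotomy i j with h | rfl | h
    · simp [h, h.not_gt]
    · simp [hf]
    · simp [h, h.not_gt]
  rw [h1, prod_comm (f := fun i j => if j < i then f i j else 1)]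
  simp only [← prod_mul_distrib]
  refine prod_congr rfl fun i _ => prod_congr rfl fun j _ => ?_
  split_ifs <;> simp

theorem sinhKernel_exp {ι : Type*} (c : ℂ) (θ : ι → ℂ) (i j : ι) :
    sinhKernel (2 * c) (fun k => Complex.exp (θ k)) i j = c / Complex.sinh (θ i - θ j) := by
  have hi := Complex.exp_ne_zero (θ i)
  have hj := Complex.exp_ne_zero (θ j)
  have h : Complex.exp (θ i) ^ 2 - Complex.exp (θ j) ^ 2 =
      2 * Complex.exp (θ i) * Complex.exp (θ j) * Complex.sinh (θ i - θ j) := by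
    rw [Complex.sinh, neg_sub, Complex.exp_sub, Complex.exp_sub]
    field_simp
  rw [sinhKernel, h, show 2 * c * Complex.exp (θ i) * Complex.exp (θ j) =
    2 * Complex.exp (θ i) * Complex.exp (θ j) * c by ring]
  exact mul_div_mul_left _ _ (by simp)

theorem Kfun_eq_mul_signedCutSum (ν : ℝ) {n : ℕ} (c : (Fin n → ℂ) → ℂ) (θ : Fin n → ℂ) :
    Kfun ν (fun θ' (_ : Fin n → Fin 2) => c θ') θ =
      signedCutSum (sinhKernel (2 * (Complex.I * (Real.sin (Real.pi * ν) : ℂ)))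
        fun k => Complex.exp (θ k)) univ * c θ := by
  simp only [Kfun, signedCutSum, sum_mul]
  refine sum_bij' (fun l _ => univ.filter fun i => l i = 1)
    (fun S _ i => if i ∈ S then 1 else 0) (by simp) (by simp) ?_ (by simp) ?_
  · intro l _
    ext i
    have := Fin.exists_fin_two.1 ⟨l i, rfl⟩
    rcases this with h | h <;> simp [h]
  · intro l _
    have hl (i : Fin n) : l i = 0 ∨ l i = 1 := by
      have := (l i).2
      omega
    congr 2
    · congr 1
      rw [card_filter]
      refine sum_congr rfl fun i _ => ?_
      rcases hl i with h | h <;> simp [h]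
    · set s : ℂ := (Real.sin (Real.pi * ν) : ℂ)
      have hc : (univ \ univ.filter fun i => l i = 1) = univ.filter fun i => ¬ l i = 1 := by
        ext i
        simp
      simp only [sinhKernel_exp, hc, prod_filter]
      have h2 : ∀ i, (if l i = 1 then
          ∏ j, (if ¬ l j = 1 then 1 + Complex.I * s / Complex.sinh (θ i - θ j) else 1) else 1) =
          ∏ j, if l i = 1 ∧ ¬ l j = 1 then 1 + Complex.I * s / Complex.sinh (θ i - θ j) else 1 := by
        intro i
        by_cases h : l i = 1 <;> simp [h]
      simp only [h2]
      refine Eq.trans ?_ (prod_prod_eq_prod_prod_lt _ fun i => by simp).symm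
      refine prod_congr rfl fun i _ => prod_congr rfl fun j _ => ?_
      by_cases hij : i < j
      swap
      · simp [hij]
      simp only [Fin.val_fin_lt, hij, if_true]
      rw [← neg_sub (θ i) (θ j), Complex.sinh_neg]
      rcases hl i with h | h <;> rcases hl j with h' | h' <;> simp [h, h', div_neg, neg_div]

/-- Lemma 1 of the paper: if the p-function does not depend on `l`,
then the K-function vanishes identically on admissible rapidities. -/
theorem Kfun_eq_zero_of_p_indep (ν : ℝ) (n : ℕ) (hn : 1 ≤ n)
    (c : (Fin n → ℂ) → ℂ) (θ : Fin n → ℂ) (hθ : Admissible θ) :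
    Kfun ν (fun θ' (_ : Fin n → Fin 2) => c θ') θ = 0 := by
  obtain ⟨m, rfl⟩ : ∃ m, n = m + 1 := ⟨n - 1, by omega⟩
  have hs : ∀ i j : Fin (m + 1), i ≠ j → Complex.sinh (θ i - θ j) ≠ 0 := by
    intro i j hij
    rcases lt_or_gt_of_ne hij with h | h
    · exact hθ i j h
    · rw [← neg_sub, Complex.sinh_neg]
      exact neg_ne_zero.2 (hθ j i h)
  rw [Kfun_eq_mul_signedCutSum, signedCutSum_sinhKernel_eq_zero univ_nonempty, zero_mul]
  · intro i _ j _ hij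
    by_contra hne
    refine hs i j hne ?_
    have hij : Complex.exp (θ i) = Complex.exp (θ j) := hij
    rw [Complex.sinh, neg_sub, Complex.exp_sub, Complex.exp_sub, hij]
    simp
  · intro i _ j _ hij
    rcases eq_or_ne i j with rfl | hne
    · simp [← two_mul] at hij
    · refine hs i j hne ?_
      rw [Complex.sinh, neg_sub, Complex.exp_sub, Complex.exp_sub, eq_neg_of_add_eq_zero_left hij]
      simp
end

section
/- (Residue recursion, the core of Theorem 1.) Fix ν ∈ ℝ and an integer n ≥ 3. Let θ_2, θ_3, …, θ_n ∈ ℂ satisfy sinh(θ_i − θ_j) ≠ 0 for all 2 ≤ i < j ≤ n. Let p_n be a p-function in n variables and p_{n−2} a p-function in the n−2 variables (θ_3,…,θ_n), and assume: (i) for each l ∈ {0,1}^n, the map θ_1 ↦ p_n((θ_1, θ_2, …, θ_n), l) is continuous at θ_1 = θ_2 + iπ; (ii) there are g_0 ∈ ℂ and a function h : {0,1}² → ℂ such that for all l with l_1 ≠ l_2, p_n((θ_2 + iπ, θ_2, θ_3, …, θ_n), (l_1, l_2, l_3, …, l_n)) = g_0 · p_{n−2}((θ_3, …, θ_n), (l_3,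 …, l_n)) + h(l_1, l_2), where h does not depend on (l_3, …, l_n). Then lim_{ε→0} ε · K_n[p_n](θ_2 + iπ + ε, θ_2, θ_3, …, θ_n) = −i·sin(πν)·g_0·( Π_{j=3}^n (1 + i·sin(πν)/sinh(θ_2 − θ_j)) − Π_{j=3}^n (1 − i·sin(πν)/sinh(θ_2 − θ_j)) ) · K_{n−2}[p_{n−2}](θ_3, …, θ_n). -/
open Finset

/-- The weight `∏_{i ∈ A, j ∈ S \ A} f i j` of the cut of `S` into `A` and `S \ A`. -/
def cutWeight {ι K : Type*} [DecidableEq ι] [CommRing K] (f : ι → ι → K) (S A : Finset ι) : K :=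
  ∏ i ∈ A, ∏ j ∈ S \ A, f i j

/-- The alternating sum over `A ⊆ S` of the cut weights. -/
def altCutSum {ι K : Type*} [DecidableEq ι] [CommRing K] (f : ι → ι → K) (S : Finset ι) : K :=
  ∑ A ∈ S.powerset, (-1) ^ #A * cutWeight f S A

lemma cutWeight_insert_left {ι K : Type*} [DecidableEq ι] [CommRing K] (f : ι → ι → K)
    {T B : Finset ι} {k : ι} (hk : k ∉ T) (hB : B ⊆ T) :
    cutWeight f (insert k T) B = cutWeight f T B * ∏ i ∈ B, f i k := by
  have hkB : k ∉ B := fun h => hk (hB h)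
  unfold cutWeight
  rw [← prod_mul_distrib]
  refine prod_congr rfl fun i _ => ?_
  rw [insert_sdiff_of_notMem _ hkB, prod_insert (by simp [hk]), mul_comm]

lemma cutWeight_insert_insert {ι K : Type*} [DecidableEq ι] [CommRing K] (f : ι → ι → K)
    {T B : Finset ι} {k : ι} (hk : k ∉ T) (hB : B ⊆ T) :
    cutWeight f (insert k T) (insert k B) = cutWeight f T B * ∏ j ∈ T \ B, f k j := by
  have hkB : k ∉ B := fun h => hk (hB h)
  unfold cutWeight
  have : insert k T \ insert k B = T \ B := by
    ext a
    simp only [mem_sdiff, mem_insert]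
    grind
  rw [this, prod_insert hkB, mul_comm]

lemma altCutSum_insert {ι K : Type*} [DecidableEq ι] [CommRing K] (f : ι → ι → K)
    {T : Finset ι} {k : ι} (hk : k ∉ T) :
    altCutSum f (insert k T) = ∑ A ∈ T.powerset, (-1) ^ #A * cutWeight f T A *
      (∏ i ∈ A, f i k - ∏ j ∈ T \ A, f k j) := by
  unfold altCutSum
  rw [sum_powerset_insert hk, ← sum_add_distrib]
  refine sum_congr rfl fun A hA => ?_
  rw [mem_powerset] at hA
  rw [cutWeight_insert_left f hk hA, cutWeight_insert_insert f hk hA,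
    card_insert_of_notMem fun h => hk (hA h)]
  ring

open Polynomial in
/-- The numerator, as a polynomial in the rapidity variable `x k`, of
`altCutSum f (insert k T)` for `f i j = 1 + 2 c xᵢ xⱼ / (xᵢ² - xⱼ²)`. -/
noncomputable def cutNumerator {ι K : Type*} [DecidableEq ι] [Field K] (c : K) (x : ι → K)
    (f : ι → ι → K) (T : Finset ι) : K[X] :=
  ∑ A ∈ T.powerset, C ((-1) ^ #A * cutWeight f T A) *
    ((∏ j ∈ A, (X ^ 2 + C (-(2 * c * x j)) * X + C (-x j ^ 2))) *
        ∏ j ∈ T \ A, (X ^ 2 + C 0 * X + C (-x j ^ 2)) -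
      (∏ j ∈ A, (X ^ 2 + C 0 * X + C (-x j ^ 2))) *
        ∏ j ∈ T \ A, (X ^ 2 + C (2 * c * x j) * X + C (-x j ^ 2)))

open Polynomial in
lemma monic_prod_quadratic {ι K : Type*} [Field K] (b d : ι → K) (A : Finset ι) :
    (∏ j ∈ A, (X ^ 2 + C (b j) * X + C (d j))).Monic ∧
      (∏ j ∈ A, (X ^ 2 + C (b j) * X + C (d j))).natDegree = 2 * #A := by
  have hm : ∀ j, (X ^ 2 + C (b j) * X + C (d j)).Monic := fun j => by monicity!
  have hd : ∀ j, (X ^ 2 + C (b j) * X + C (d j)).natDegree = 2 := fun j => by compute_degree!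
  refine ⟨monic_prod_of_monic _ _ fun j _ => hm j, ?_⟩
  rw [natDegree_prod_of_monic _ _ fun j _ => hm j]
  rw [sum_congr rfl fun j _ => hd j, sum_const, smul_eq_mul, mul_comm]

lemma degree_cutNumerator_lt {ι K : Type*} [DecidableEq ι] [Field K] (c : K) (x : ι → K)
    (f : ι → ι → K) (T : Finset ι) :
    (cutNumerator c x f T).degree < ((2 * #T : ℕ) : WithBot ℕ) := by
  unfold cutNumerator
  refine (Polynomial.degree_sum_le _ _).trans_lt ?_
  rw [Finset.sup_lt_iff (WithBot.bot_lt_coe _)]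
  intro A hA
  rw [mem_powerset] at hA
  refine (Polynomial.degree_mul_le _ _).trans_lt ?_
  refine (add_le_add_left Polynomial.degree_C_le _).trans_lt ?_
  rw [zero_add]
  obtain ⟨m1, d1⟩ := monic_prod_quadratic (fun j => -(2 * c * x j)) (fun j => -x j ^ 2) A
  obtain ⟨m2, d2⟩ := monic_prod_quadratic (fun _ => 0) (fun j => -x j ^ 2) (T \ A)
  obtain ⟨m3, d3⟩ := monic_prod_quadratic (fun _ => 0) (fun j => -x j ^ 2) A
  obtain ⟨m4, d4⟩ := monic_prod_quadratic (fun j => 2 * c * x j) (fun j => -x j ^ 2) (T \ A)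
  have m12 := m1.mul m2
  have m34 := m3.mul m4
  have hcard : 2 * #A + 2 * #(T \ A) = 2 * #T := by
    have := card_sdiff_add_card_eq_card hA
    lia
  have d12 := m1.natDegree_mul m2
  have d34 := m3.natDegree_mul m4
  rw [d1, d2, hcard] at d12
  rw [d3, d4, hcard] at d34
  have e12 := (Polynomial.degree_eq_natDegree m12.ne_zero).trans (congrArg _ d12)
  have e34 := (Polynomial.degree_eq_natDegree m34.ne_zero).trans (congrArg _ d34)
  exact (Polynomial.degree_sub_lt_left (e12.trans e34.symm) m12.ne_zero
    (m12.leadingCoeff.trans m34.leadingCoeff.symm)).trans_eq e12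

lemma eval_cutNumerator {ι K : Type*} [DecidableEq ι] [Field K] (c : K) (x : ι → K)
    (f : ι → ι → K) (T : Finset ι) (y : K) :
    (cutNumerator c x f T).eval y = ∑ A ∈ T.powerset, (-1) ^ #A * cutWeight f T A *
      ((∏ j ∈ A, (y ^ 2 - x j ^ 2 - 2 * c * x j * y)) * ∏ j ∈ T \ A, (y ^ 2 - x j ^ 2) -
        (∏ j ∈ A, (y ^ 2 - x j ^ 2)) * ∏ j ∈ T \ A, (y ^ 2 - x j ^ 2 + 2 * c * x j * y)) := by
  simp only [cutNumerator, Polynomial.eval_finsetSum, Polynomial.eval_mul, Polynomial.eval_C,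
    Polynomial.eval_sub, Polynomial.eval_prod, Polynomial.eval_add, Polynomial.eval_pow,
    Polynomial.eval_X]
  refine sum_congr rfl fun A _ => ?_
  congr 3 <;> refine prod_congr rfl fun j _ => by ring

/-- Splitting off one element `k` in the evaluation of the numerator at a point with `y² = x k²`. -/
lemma eval_cutNumerator_insert {ι K : Type*} [DecidableEq ι] [Field K] (c : K) (x : ι → K)
    (f : ι → ι → K) {T : Finset ι} {k : ι} (hk : k ∉ T) {y : K} (hy : y ^ 2 = x k ^ 2) :
    (cutNumerator c x f (insert k T)).eval y = ∑ A ∈ T.powerset, (-1) ^ #A * cutWeight f T A *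
      (2 * c * x k * y) *
      ((∏ j ∈ T \ A, f k j) * ((∏ j ∈ A, (y ^ 2 - x j ^ 2 - 2 * c * x j * y)) *
          ∏ j ∈ T \ A, (y ^ 2 - x j ^ 2)) -
        (∏ i ∈ A, f i k) * ((∏ j ∈ A, (y ^ 2 - x j ^ 2)) *
          ∏ j ∈ T \ A, (y ^ 2 - x j ^ 2 + 2 * c * x j * y))) := by
  rw [eval_cutNumerator, sum_powerset_insert hk, ← sum_add_distrib]
  refine sum_congr rfl fun A hA => ?_
  rw [mem_powerset] at hA
  have hkA : k ∉ A := fun h => hk (hA h)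
  have hkTA : k ∉ T \ A := by simp [hk]
  have hs : insert k T \ insert k A = T \ A := by
    ext a
    simp only [mem_sdiff, mem_insert]
    grind
  rw [cutWeight_insert_left f hk hA, cutWeight_insert_insert f hk hA,
    card_insert_of_notMem hkA, hs, insert_sdiff_of_notMem _ hkA]
  simp only [prod_insert hkA, prod_insert hkTA, hy, sub_self, zero_mul, mul_zero, zero_sub,
    sub_zero, zero_add]
  ring

/-- The alternating cut sum with weights `1 + 2 c xᵢ xⱼ / (xᵢ² - xⱼ²)` vanishes. -/
theorem altCutSum_eq_zero {ι K : Type*} [DecidableEq ι] [Field K] [NeZero (2 : K)] (c : K)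
    (x : ι → K) (f : ι → ι → K) (S : Finset ι) (hS : S.Nonempty) (hx : ∀ i ∈ S, x i ≠ 0)
    (hd : ∀ i ∈ S, ∀ j ∈ S, i ≠ j → x i ^ 2 - x j ^ 2 ≠ 0)
    (hf : ∀ i ∈ S, ∀ j ∈ S, i ≠ j →
      (x i ^ 2 - x j ^ 2) * f i j = x i ^ 2 - x j ^ 2 + 2 * c * x i * x j) :
    altCutSum f S = 0 := by
  induction S using Finset.strongInduction with
  | H S ih =>
  obtain ⟨z, hz⟩ := hS
  obtain ⟨T, hzT, rfl⟩ : ∃ T, z ∉ T ∧ insert z T = S :=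
    ⟨S.erase z, notMem_erase z S, insert_erase hz⟩
  have hT : ∀ {i}, i ∈ T → i ∈ insert z T := mem_insert_of_mem
  have hzero : cutNumerator c x f T = 0 := by
    have hinj : Set.InjOn (Sum.elim x fun i => -x i) (T.disjSum T : Finset (ι ⊕ ι)) := by
      have key : ∀ i ∈ T, ∀ j ∈ T, x i ^ 2 = x j ^ 2 → i = j := fun i hi j hj h => by
        by_contra hij
        exact hd i (hT hi) j (hT hj) hij (sub_eq_zero.2 h)
      have key' : ∀ i ∈ T, ∀ j ∈ T, x i ≠ -x j := fun i hi j hj h => by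
        obtain rfl := key i hi j hj (by rw [h, neg_sq])
        have h2 : 2 * x i = 0 := by linear_combination h
        exact hx i (hT hi) ((mul_eq_zero.1 h2).resolve_left two_ne_zero)
      rintro (i | i) hi (j | j) hj hij <;> simp at hi hj hij
      · rw [key i hi j hj (by rw [hij])]
      · exact absurd hij (key' i hi j hj)
      · exact absurd hij.symm (key' j hj i hi)
      · rw [key i hi j hj (by rw [hij])]
    refine Polynomial.eq_zero_of_degree_lt_of_eval_index_eq_zero _ hinj ?_ ?_
    · rw [card_disjSum, ← two_mul]
      exact degree_cutNumerator_lt c x f T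
    · have split : ∀ k ∈ T, ∃ R, k ∉ R ∧ insert k R = T := fun k hk =>
        ⟨T.erase k, notMem_erase k T, insert_erase hk⟩
      rintro (k | k) hkT <;> simp at hkT
      · obtain ⟨R, hkR, rfl⟩ := split k hkT
        simp only [Sum.elim_inl]
        rw [eval_cutNumerator_insert c x f hkR rfl]
        refine sum_eq_zero fun A hA => ?_
        rw [mem_powerset] at hA
        have hne : ∀ j ∈ R, j ≠ k := fun j hj h => hkR (h ▸ hj)
        have hmem : ∀ j ∈ R, j ∈ insert z (insert k R) := fun j hj => by simp [hj]
        have e1 : ∏ j ∈ A, (x k ^ 2 - x j ^ 2 - 2 * c * x j * x k) =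
            (∏ j ∈ A, (x k ^ 2 - x j ^ 2)) * ∏ j ∈ A, f j k := by
          rw [← prod_mul_distrib]
          refine prod_congr rfl fun j hj => ?_
          linear_combination hf j (hmem j (hA hj)) k (by simp) (hne j (hA hj))
        have e2 : ∏ j ∈ R \ A, (x k ^ 2 - x j ^ 2 + 2 * c * x j * x k) =
            (∏ j ∈ R \ A, (x k ^ 2 - x j ^ 2)) * ∏ j ∈ R \ A, f k j := by
          rw [← prod_mul_distrib]
          refine prod_congr rfl fun j hj => ?_
          have hj := (mem_sdiff.1 hj).1
          linear_combination -hf k (by simp) j (hmem j hj) (hne j hj).symm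
        rw [e1, e2]
        ring
      · obtain ⟨R, hkR, rfl⟩ := split k hkT
        simp only [Sum.elim_inr]
        rw [eval_cutNumerator_insert c x f hkR (neg_sq _)]
        have hne : ∀ j ∈ R, j ≠ k := fun j hj h => hkR (h ▸ hj)
        have hmem : ∀ j ∈ R, j ∈ insert z (insert k R) := fun j hj => by simp [hj]
        have term : ∀ A ∈ R.powerset, (-1) ^ #A * cutWeight f R A * (2 * c * x k * -x k) *
            ((∏ j ∈ R \ A, f k j) * ((∏ j ∈ A, ((-x k) ^ 2 - x j ^ 2 - 2 * c * x j * -x k)) *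
              ∏ j ∈ R \ A, ((-x k) ^ 2 - x j ^ 2)) -
            (∏ i ∈ A, f i k) * ((∏ j ∈ A, ((-x k) ^ 2 - x j ^ 2)) *
              ∏ j ∈ R \ A, ((-x k) ^ 2 - x j ^ 2 + 2 * c * x j * -x k))) =
            (-1) ^ #A * cutWeight f R A * ((2 * c * x k * -x k) *
              (∏ j ∈ R, (x k ^ 2 - x j ^ 2)) * (∏ j ∈ R, f k j - ∏ j ∈ R, f j k)) := by
          intro A hA
          rw [mem_powerset] at hA
          have e1 : ∏ j ∈ A, ((-x k) ^ 2 - x j ^ 2 - 2 * c * x j * -x k) =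
              (∏ j ∈ A, (x k ^ 2 - x j ^ 2)) * ∏ j ∈ A, f k j := by
            rw [← prod_mul_distrib]
            refine prod_congr rfl fun j hj => ?_
            linear_combination -hf k (by simp) j (hmem j (hA hj)) (hne j (hA hj)).symm
          have e2 : ∏ j ∈ R \ A, ((-x k) ^ 2 - x j ^ 2 + 2 * c * x j * -x k) =
              (∏ j ∈ R \ A, (x k ^ 2 - x j ^ 2)) * ∏ j ∈ R \ A, f j k := by
            rw [← prod_mul_distrib]
            refine prod_congr rfl fun j hj => ?_
            have hj := (mem_sdiff.1 hj).1
            linear_combination hf j (hmem j hj) k (by simp) (hne j hj)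
          rw [e1, e2, neg_sq, ← prod_sdiff hA, ← prod_sdiff hA, ← prod_sdiff hA]
          ring
        rw [sum_congr rfl term, ← sum_mul]
        rcases R.eq_empty_or_nonempty with rfl | hR
        · simp
        · have hRz : ∀ {i}, i ∈ R → i ∈ insert z (insert k R) := fun h => hmem _ h
          have := ih R ⟨fun i => hRz, fun h =>
            hzT (mem_insert_of_mem (h (mem_insert_self z _)))⟩ hR (fun i hi => hx i (hRz hi))
            (fun i hi j hj => hd i (hRz hi) j (hRz hj))
            (fun i hi j hj => hf i (hRz hi) j (hRz hj))
          unfold altCutSum at this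
          rw [this, zero_mul]
  have heval := eval_cutNumerator c x f T (x z)
  rw [hzero, Polynomial.eval_zero] at heval
  have hne : ∀ j ∈ T, j ≠ z := fun j hj h => hzT (h ▸ hj)
  have hD : ∏ j ∈ T, (x z ^ 2 - x j ^ 2) ≠ 0 :=
    prod_ne_zero_iff.2 fun j hj => hd z (by simp) j (hT hj) (hne j hj).symm
  refine (mul_eq_zero.1
    (?_ : (∏ j ∈ T, (x z ^ 2 - x j ^ 2)) * altCutSum f (insert z T) = 0)).resolve_left hD
  rw [altCutSum_insert f hzT, mul_sum, heval]
  refine sum_congr rfl fun A hA => ?_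
  rw [mem_powerset] at hA
  have e1 : ∏ j ∈ A, (x z ^ 2 - x j ^ 2 - 2 * c * x j * x z) =
      (∏ j ∈ A, (x z ^ 2 - x j ^ 2)) * ∏ j ∈ A, f j z := by
    rw [← prod_mul_distrib]
    refine prod_congr rfl fun j hj => ?_
    linear_combination hf j (hT (hA hj)) z (by simp) (hne j (hA hj))
  have e2 : ∏ j ∈ T \ A, (x z ^ 2 - x j ^ 2 + 2 * c * x j * x z) =
      (∏ j ∈ T \ A, (x z ^ 2 - x j ^ 2)) * ∏ j ∈ T \ A, f z j := by
    rw [← prod_mul_distrib]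
    refine prod_congr rfl fun j hj => ?_
    have hj := (mem_sdiff.1 hj).1
    linear_combination -hf z (by simp) j (hT hj) (hne j hj).symm
  rw [e1, e2, ← prod_sdiff hA]
  ring

/-- The product over pairs `i < j` of the scattering factors in the K-function. -/
noncomputable def pairWeight (ν : ℝ) {n : ℕ} (θ : Fin n → ℂ) (l : Fin n → Fin 2) : ℂ :=
  ∏ i : Fin n, ∏ j : Fin n,
    if (i : ℕ) < (j : ℕ) then
      1 + (((l i : ℕ) : ℂ) - ((l j : ℕ) : ℂ)) * Complex.I *
        (Real.sin (Real.pi * ν) : ℂ) / Complex.sinh (θ i - θ j)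
    else 1

lemma pairWeight_cons (ν : ℝ) {n : ℕ} (z : ℂ) (θ : Fin n → ℂ) (a : Fin 2) (l : Fin n → Fin 2) :
    pairWeight ν (Fin.cons z θ) (Fin.cons a l) =
      (∏ j, (1 + (((a : ℕ) : ℂ) - ((l j : ℕ) : ℂ)) * Complex.I *
        (Real.sin (Real.pi * ν) : ℂ) / Complex.sinh (z - θ j))) * pairWeight ν θ l := by
  simp [pairWeight, Fin.prod_univ_succ]

lemma Kfun_eq_sum_pairWeight (ν : ℝ) {n : ℕ} (p : (Fin n → ℂ) → (Fin n → Fin 2) → ℂ)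
    (θ : Fin n → ℂ) :
    Kfun ν p θ = ∑ l, (-1 : ℂ) ^ (∑ i, (l i : ℕ)) * pairWeight ν θ l * p θ l := rfl

lemma sum_fin_succ_arrow {n : ℕ} (F : (Fin (n + 1) → Fin 2) → ℂ) :
    ∑ l, F l = ∑ a, ∑ l, F (Fin.cons a l) := by
  rw [← (Fin.consEquiv fun _ => Fin 2).sum_comp, Fintype.sum_prod_type]
  rfl

lemma pairWeight_eq_cutWeight (ν : ℝ) {n : ℕ} (θ : Fin n → ℂ) (l : Fin n → Fin 2) :
    pairWeight ν θ l = cutWeight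
      (fun i j => 1 + Complex.I * (Real.sin (Real.pi * ν) : ℂ) / Complex.sinh (θ i - θ j))
      univ {i | l i = 1} := by
  set f : Fin n → Fin n → ℂ :=
    fun i j => 1 + Complex.I * (Real.sin (Real.pi * ν) : ℂ) / Complex.sinh (θ i - θ j) with hf
  set u : Fin n → Fin n → ℂ := fun i j => if l i = 1 ∧ l j = 0 then f i j else 1 with hu
  have h01 : ∀ a : Fin 2, a = 0 ∨ a = 1 := by decide
  have hcut : cutWeight f univ {i | l i = 1} = ∏ i, ∏ j, u i j := by
    unfold cutWeight
    rw [prod_filter]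
    refine prod_congr rfl fun i _ => ?_
    have hs : (univ \ ({i | l i = 1} : Finset (Fin n))) = ({j | l j = 0} : Finset (Fin n)) := by
      ext j
      rcases h01 (l j) with h | h <;> simp [h]
    rw [hs, prod_filter]
    by_cases h : l i = 1 <;> simp [hu, h]
  have hsplit : ∀ i j, u i j = (if (i : ℕ) < j then u i j else 1) *
      (if (j : ℕ) < i then u i j else 1) := by
    intro i j
    rcases lt_trichotomy (i : ℕ) j with h | h | h
    · simp [h, h.not_gt]
    · obtain rfl := Fin.ext h
      rcases h01 (l i) with h | h <;> simp [hu, h]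
    · simp [h, h.not_gt]
  rw [hcut]
  simp_rw [fun i => prod_congr (rfl : (univ : Finset (Fin n)) = univ) fun j _ => hsplit i j]
  simp_rw [prod_mul_distrib]
  rw [prod_comm (f := fun i j : Fin n => if (j : ℕ) < i then u i j else 1), ← prod_mul_distrib]
  unfold pairWeight
  refine prod_congr rfl fun i _ => ?_
  rw [← prod_mul_distrib]
  refine prod_congr rfl fun j _ => ?_
  split_ifs with h
  · have hs : Complex.sinh (θ j - θ i) = -Complex.sinh (θ i - θ j) := by
      rw [← Complex.sinh_neg, neg_sub]
    rcases h01 (l i) with h | h <;> rcases h01 (l j) with h' | h' <;>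
      simp [hu, hf, h, h', hs, div_neg, neg_div]
  · simp

lemma exp_sq_sub_exp_sq (a b : ℂ) :
    Complex.exp a ^ 2 - Complex.exp b ^ 2 =
      2 * Complex.exp a * Complex.exp b * Complex.sinh (a - b) := by
  rw [Complex.sinh, neg_sub, Complex.exp_sub, Complex.exp_sub]
  have ha := Complex.exp_ne_zero a
  have hb := Complex.exp_ne_zero b
  field_simp

/-- The K-function of the constant p-function vanishes. -/
theorem sum_pairWeight_eq_zero (ν : ℝ) {n : ℕ} (hn : 1 ≤ n) (θ : Fin n → ℂ) (hθ : Admissible θ) :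
    ∑ l : Fin n → Fin 2, (-1 : ℂ) ^ (∑ i, (l i : ℕ)) * pairWeight ν θ l = 0 := by
  have hsinh : ∀ i j, i ≠ j → Complex.sinh (θ i - θ j) ≠ 0 := by
    intro i j hij
    rcases lt_or_gt_of_ne hij with h | h
    · exact hθ i j h
    · rw [← neg_sub, Complex.sinh_neg]
      exact neg_ne_zero.2 (hθ j i h)
  have h01 : ∀ a : Fin 2, a = 0 ∨ a = 1 := by decide
  rw [← altCutSum_eq_zero (Complex.I * (Real.sin (Real.pi * ν) : ℂ)) (fun i => Complex.exp (θ i))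
    (fun i j => 1 + Complex.I * (Real.sin (Real.pi * ν) : ℂ) / Complex.sinh (θ i - θ j)) univ
    ⟨⟨0, hn⟩, mem_univ _⟩ (fun i _ => Complex.exp_ne_zero _)
    (fun i _ j _ hij => by
      rw [exp_sq_sub_exp_sq]
      simp [hsinh i j hij, Complex.exp_ne_zero])
    (fun i _ j _ hij => by
      rw [exp_sq_sub_exp_sq]
      have := hsinh i j hij
      field_simp)]
  unfold altCutSum
  refine sum_nbij' (fun l => ({i | l i = 1} : Finset (Fin n))) (fun A i => if i ∈ A then 1 else 0) ?_ ?_ ?_ ?_ ?_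
  · simp
  · simp
  · intro l _
    funext i
    rcases h01 (l i) with h | h <;> simp [h]
  · intro A _
    ext i
    simp
  · intro l _
    rw [pairWeight_eq_cutWeight, card_filter]
    congr 2
    refine sum_congr rfl fun i _ => ?_
    rcases h01 (l i) with h | h <;> simp [h]

/-- The limit of `ε` times the singular scattering factor at `θ₁ = θ₂ + iπ + ε`. -/
lemma tendsto_mul_one_add_div_sinh (c : ℂ) :
    Filter.Tendsto (fun ε : ℂ => ε * (1 + c / -Complex.sinh ε)) (nhdsWithin 0 {(0 : ℂ)}ᶜ)
      (nhds (-c)) := by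
  have h1 : Filter.Tendsto (fun ε : ℂ => ε⁻¹ * Complex.sinh ε) (nhdsWithin 0 {(0 : ℂ)}ᶜ)
      (nhds 1) := by
    have := hasDerivAt_iff_tendsto_slope_zero.1 (Complex.hasDerivAt_sinh 0)
    simpa using this
  have h2 : Filter.Tendsto (fun ε : ℂ => ε) (nhdsWithin 0 {(0 : ℂ)}ᶜ) (nhds 0) :=
    Filter.tendsto_id.mono_left nhdsWithin_le_nhds
  have h3 := h2.sub ((h1.inv₀ one_ne_zero).const_mul c)
  simp only [inv_one, mul_one, zero_sub] at h3
  refine h3.congr fun ε => ?_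
  rw [mul_inv, inv_inv, div_neg, div_eq_mul_inv]
  ring

lemma sinh_add_pi_mul_I (z : ℂ) :
    Complex.sinh (z + (Real.pi : ℂ) * Complex.I) = -Complex.sinh z := by
  simp [Complex.sinh_add, Complex.cosh_mul_I, Complex.sinh_mul_I]

/-- residue recursion, the core of Theorem 1.  Here `n = m + 2` with
`m ≥ 1`, the rapidities are `(θ₁, θ₂, τ 0, …, τ (m−1))` with `θ₁ = θ₂ + iπ + ε`, and
`ε·K_n[p_n] → −i sin(πν) g₀ (Π_j (1 + i sin(πν)/sinh(θ₂−τ_j)) − Π_j (1 − i sin(πν)/sinh(θ₂−τ_j))) · K_{n−2}[p_{n−2}](τ)`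
as `ε → 0`. -/
theorem residue_recursion (ν : ℝ) (m : ℕ) (hm : 1 ≤ m)
    (θ₂ : ℂ) (τ : Fin m → ℂ)
    (h2 : ∀ j : Fin m, Complex.sinh (θ₂ - τ j) ≠ 0)
    (hτ : Admissible τ)
    (pn : (Fin (m + 2) → ℂ) → (Fin (m + 2) → Fin 2) → ℂ)
    (pm : (Fin m → ℂ) → (Fin m → Fin 2) → ℂ)
    (hcont : ∀ l : Fin (m + 2) → Fin 2,
      ContinuousAt (fun z : ℂ => pn (Fin.cons z (Fin.cons θ₂ τ)) l)
        (θ₂ + (Real.pi : ℂ) * Complex.I))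
    (g₀ : ℂ) (h : Fin 2 → Fin 2 → ℂ)
    (hrec : ∀ l : Fin (m + 2) → Fin 2, l 0 ≠ l 1 →
      pn (Fin.cons (θ₂ + (Real.pi : ℂ) * Complex.I) (Fin.cons θ₂ τ)) l
        = g₀ * pm τ (fun i => l i.succ.succ) + h (l 0) (l 1)) :
    Filter.Tendsto
      (fun ε : ℂ =>
        ε * Kfun ν pn (Fin.cons (θ₂ + (Real.pi : ℂ) * Complex.I + ε) (Fin.cons θ₂ τ)))
      (nhdsWithin 0 {(0 : ℂ)}ᶜ)
      (nhds (-Complex.I * (Real.sin (Real.pi * ν) : ℂ) * g₀ *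
        ((∏ j : Fin m,
            (1 + Complex.I * (Real.sin (Real.pi * ν) : ℂ) / Complex.sinh (θ₂ - τ j))) -
         (∏ j : Fin m,
            (1 - Complex.I * (Real.sin (Real.pi * ν) : ℂ) / Complex.sinh (θ₂ - τ j)))) *
        Kfun ν pm τ)) := by
  set s : ℂ := (Real.sin (Real.pi * ν) : ℂ) with hs
  have hlim : ∀ (a b : Fin 2) (l : Fin m → Fin 2), Filter.Tendsto
      (fun ε : ℂ => ε * ((-1 : ℂ) ^
          (∑ i, ((Fin.cons a (Fin.cons b l) : Fin (m + 2) → Fin 2) i : ℕ)) *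
        pairWeight ν (Fin.cons (θ₂ + (Real.pi : ℂ) * Complex.I + ε) (Fin.cons θ₂ τ))
          (Fin.cons a (Fin.cons b l)) *
        pn (Fin.cons (θ₂ + (Real.pi : ℂ) * Complex.I + ε) (Fin.cons θ₂ τ))
          (Fin.cons a (Fin.cons b l))))
      (nhdsWithin 0 {(0 : ℂ)}ᶜ)
      (nhds (-((((a : ℕ) : ℂ) - ((b : ℕ) : ℂ)) * Complex.I * s) *
        ((-1 : ℂ) ^ ((a : ℕ) + ((b : ℕ) + ∑ i, (l i : ℕ))) *
        ((∏ j, (1 + (((a : ℕ) : ℂ) - ((l j : ℕ) : ℂ)) * Complex.I * s /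
            -Complex.sinh (θ₂ - τ j))) *
          ((∏ j, (1 + (((b : ℕ) : ℂ) - ((l j : ℕ) : ℂ)) * Complex.I * s /
            Complex.sinh (θ₂ - τ j))) * pairWeight ν τ l)) *
        pn (Fin.cons (θ₂ + (Real.pi : ℂ) * Complex.I) (Fin.cons θ₂ τ))
          (Fin.cons a (Fin.cons b l))))) := by
    intro a b l
    have hp : Filter.Tendsto
        (fun ε : ℂ => pn (Fin.cons (θ₂ + (Real.pi : ℂ) * Complex.I + ε) (Fin.cons θ₂ τ))
          (Fin.cons a (Fin.cons b l))) (nhdsWithin 0 {(0 : ℂ)}ᶜ)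
        (nhds (pn (Fin.cons (θ₂ + (Real.pi : ℂ) * Complex.I) (Fin.cons θ₂ τ))
          (Fin.cons a (Fin.cons b l)))) := by
      have ht : Filter.Tendsto (fun ε : ℂ => θ₂ + (Real.pi : ℂ) * Complex.I + ε)
          (nhdsWithin 0 {(0 : ℂ)}ᶜ) (nhds (θ₂ + (Real.pi : ℂ) * Complex.I)) := by
        have : Continuous (fun ε : ℂ => θ₂ + (Real.pi : ℂ) * Complex.I + ε) := by fun_prop
        simpa using (this.tendsto 0).mono_left (nhdsWithin_le_nhds (s := {(0 : ℂ)}ᶜ))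
      exact (hcont (Fin.cons a (Fin.cons b l))).tendsto.comp ht
    have hprod : Filter.Tendsto
        (fun ε : ℂ => ∏ j, (1 + (((a : ℕ) : ℂ) - ((l j : ℕ) : ℂ)) * Complex.I * s /
            -Complex.sinh (θ₂ + ε - τ j))) (nhdsWithin 0 {(0 : ℂ)}ᶜ)
        (nhds (∏ j, (1 + (((a : ℕ) : ℂ) - ((l j : ℕ) : ℂ)) * Complex.I * s /
            -Complex.sinh (θ₂ - τ j)))) := by
      refine tendsto_finsetProd _ fun j _ => ?_
      have hc : Continuous fun ε : ℂ => -Complex.sinh (θ₂ + ε - τ j) := by fun_prop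
      have ht := (hc.tendsto 0).mono_left (nhdsWithin_le_nhds (s := {(0 : ℂ)}ᶜ))
      rw [add_zero] at ht
      exact (tendsto_const_nhds.div ht (neg_ne_zero.2 (h2 j))).const_add 1
    have hall := (tendsto_mul_one_add_div_sinh
      ((((a : ℕ) : ℂ) - ((b : ℕ) : ℂ)) * Complex.I * s)).mul
      (((hprod.mul_const ((∏ j, (1 + (((b : ℕ) : ℂ) - ((l j : ℕ) : ℂ)) * Complex.I * s /
            Complex.sinh (θ₂ - τ j))) * pairWeight ν τ l)).const_mul
        ((-1 : ℂ) ^ ((a : ℕ) + ((b : ℕ) + ∑ i, (l i : ℕ))))).mul hp)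
    refine hall.congr fun ε => ?_
    rw [pairWeight_cons, pairWeight_cons, Fin.prod_univ_succ, Fin.sum_univ_succ, Fin.sum_univ_succ]
    simp only [Fin.cons_zero, Fin.cons_succ]
    have e0 : Complex.sinh (θ₂ + (Real.pi : ℂ) * Complex.I + ε - θ₂) = -Complex.sinh ε := by
      rw [← sinh_add_pi_mul_I]
      congr 1
      ring
    have ej : ∀ j, Complex.sinh (θ₂ + (Real.pi : ℂ) * Complex.I + ε - τ j) =
        -Complex.sinh (θ₂ + ε - τ j) := fun j => by
      rw [← sinh_add_pi_mul_I]
      congr 1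
      ring
    simp only [e0, ej]
    ring
  have hsum := tendsto_finsetSum univ fun a _ => tendsto_finsetSum univ fun b _ =>
    tendsto_finsetSum univ fun l _ => hlim a b l
  convert hsum using 2 with ε
  · rw [Kfun_eq_sum_pairWeight, sum_fin_succ_arrow]
    simp_rw [sum_fin_succ_arrow, mul_sum]
  have hone : ∀ l : Fin m → Fin 2,
      (∏ j, (1 + (((1 : ℕ) : ℂ) - ((l j : ℕ) : ℂ)) * Complex.I * s / -Complex.sinh (θ₂ - τ j))) *
        (∏ j, (1 + (((0 : ℕ) : ℂ) - ((l j : ℕ) : ℂ)) * Complex.I * s / Complex.sinh (θ₂ - τ j))) =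
      ∏ j, (1 - Complex.I * s / Complex.sinh (θ₂ - τ j)) := by
    intro l
    rw [← prod_mul_distrib]
    refine prod_congr rfl fun j _ => ?_
    rcases (by decide : ∀ a : Fin 2, a = 0 ∨ a = 1) (l j) with h | h <;>
      simp [h, div_neg, neg_div, sub_eq_add_neg]
  have hzero : ∀ l : Fin m → Fin 2,
      (∏ j, (1 + (((0 : ℕ) : ℂ) - ((l j : ℕ) : ℂ)) * Complex.I * s / -Complex.sinh (θ₂ - τ j))) *
        (∏ j, (1 + (((1 : ℕ) : ℂ) - ((l j : ℕ) : ℂ)) * Complex.I * s / Complex.sinh (θ₂ - τ j))) =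
      ∏ j, (1 + Complex.I * s / Complex.sinh (θ₂ - τ j)) := by
    intro l
    rw [← prod_mul_distrib]
    refine prod_congr rfl fun j _ => ?_
    rcases (by decide : ∀ a : Fin 2, a = 0 ∨ a = 1) (l j) with h | h <;>
      simp [h]
  have hK := sum_pairWeight_eq_zero ν hm τ hτ
  set P := ∏ j, (1 + Complex.I * s / Complex.sinh (θ₂ - τ j)) with hP
  set Q := ∏ j, (1 - Complex.I * s / Complex.sinh (θ₂ - τ j)) with hQ
  have hpn : ∀ (a b : Fin 2) (l : Fin m → Fin 2), a ≠ b →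
      pn (Fin.cons (θ₂ + (Real.pi : ℂ) * Complex.I) (Fin.cons θ₂ τ)) (Fin.cons a (Fin.cons b l)) =
        g₀ * pm τ l + h a b := fun a b l hab => by
    rw [hrec (Fin.cons a (Fin.cons b l)) (by simpa using hab)]
    rfl
  have hsum_affine : ∀ t : ℂ, ∑ l : Fin m → Fin 2, (-1 : ℂ) ^ (∑ i, (l i : ℕ)) *
      pairWeight ν τ l * (g₀ * pm τ l + t) = g₀ * Kfun ν pm τ := fun t => by
    simp_rw [mul_add, sum_add_distrib]
    rw [← sum_mul, hK, zero_mul, add_zero, Kfun_eq_sum_pairWeight, mul_sum]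
    exact sum_congr rfl fun l _ => by ring
  rw [Fin.sum_univ_two, Fin.sum_univ_two, Fin.sum_univ_two]
  simp only [sub_self, zero_mul, neg_zero, sum_const_zero, zero_add, add_zero]
  calc
    _ = -Complex.I * s * P * (g₀ * Kfun ν pm τ) + Complex.I * s * Q * (g₀ * Kfun ν pm τ) := by ring
    _ = _ := ?_
  congr 1
  · rw [← hsum_affine (h 0 1), mul_sum]
    refine sum_congr rfl fun l _ => ?_
    rw [hpn 0 1 l (by decide), ← hzero l]
    simp only [Fin.val_zero, Fin.val_one, pow_add]
    push_cast
    ring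
  · rw [← hsum_affine (h 1 0), mul_sum]
    refine sum_congr rfl fun l _ => ?_
    rw [hpn 1 0 l (by decide), ← hone l]
    simp only [Fin.val_zero, Fin.val_one, pow_add]
    push_cast
    ring
end

section
/- (Lemma 2, first identity, with corrected sign.) For every ν ∈ ℝ, every integer n ≥ 1, every q ∈ ℂ with q ≠ 0, and every admissible θ ∈ ℂ^n: K̃_n^{(1/q)}(θ) = (−1)^n · K̃_n^{(q)}(θ). In other words, the K-function of the general exponential operator is even under q ↦ 1/q when n is even and odd when n is odd. -/
open Finset

/-- p-function of the exponential operator: `p^{(q)}(θ,l) = Π_i q^{(−1)^{l_i}}`. -/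
noncomputable def pq (q : ℂ) {n : ℕ} : (Fin n → ℂ) → (Fin n → Fin 2) → ℂ :=
  fun _ l => ∏ i, q ^ ((-1 : ℤ) ^ (l i : ℕ))

section BipartitionSum

variable {ι : Type*}

/-- The two-body factor `1 + c / sinh (θ i - θ j)` in the variables `x = exp θ`. -/
noncomputable def pairFactor (x : ι → ℂ) (c : ℂ) (i j : ι) : ℂ :=
  1 + c * (2 * x i * x j / (x i ^ 2 - x j ^ 2))

lemma pairFactor_mul_left {x : ι → ℂ} {i j : ι} (c : ℂ) (h : x i ^ 2 ≠ x j ^ 2) :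
    (x i ^ 2 - x j ^ 2) * pairFactor x c i j = x i ^ 2 - x j ^ 2 + 2 * c * x j * x i := by
  have := sub_ne_zero.2 h
  rw [pairFactor]; field_simp

lemma pairFactor_mul_right {x : ι → ℂ} {i j : ι} (c : ℂ) (h : x i ^ 2 ≠ x j ^ 2) :
    (x j ^ 2 - x i ^ 2) * pairFactor x c i j = x j ^ 2 - x i ^ 2 - 2 * c * x i * x j := by
  have := sub_ne_zero.2 h
  rw [pairFactor]; field_simp; ring

variable [DecidableEq ι]

/-- The product of `f i j` over the pairs with `i ∈ S` and `j ∈ s \ S`. -/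
def cutProd (f : ι → ι → ℂ) (s S : Finset ι) : ℂ :=
  ∏ i ∈ S, ∏ j ∈ s \ S, f i j

/-- The generating function of `cutProd` over all subsets of `s`, by cardinality. -/
def cutSum (f : ι → ι → ℂ) (w : ℂ) (s : Finset ι) : ℂ :=
  ∑ S ∈ s.powerset, w ^ #S * cutProd f s S

lemma cutProd_insert_left (f : ι → ι → ℂ) {a : ι} {t S : Finset ι} (ha : a ∉ t) (hS : S ⊆ t) :
    cutProd f (insert a t) S = cutProd f t S * ∏ i ∈ S, f i a := by
  have haS : a ∉ S := fun h => ha (hS h)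
  have h : insert a t \ S = insert a (t \ S) := insert_sdiff_of_notMem _ haS
  have h' : a ∉ t \ S := fun h => ha (mem_sdiff.1 h).1
  simp only [cutProd, h]
  rw [← prod_mul_distrib]
  exact prod_congr rfl fun i _ => by rw [prod_insert h', mul_comm]

lemma cutProd_insert_insert (f : ι → ι → ℂ) {a : ι} {t S : Finset ι} (ha : a ∉ t) (hS : S ⊆ t) :
    cutProd f (insert a t) (insert a S) = cutProd f t S * ∏ j ∈ t \ S, f a j := by
  have haS : a ∉ S := fun h => ha (hS h)
  have h : insert a t \ insert a S = t \ S := by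
    ext i; simp only [mem_sdiff, mem_insert]; grind
  rw [cutProd, prod_insert haS, h, mul_comm, cutProd]

lemma cutSum_insert (f : ι → ι → ℂ) (w : ℂ) {a : ι} {t : Finset ι} (ha : a ∉ t) :
    cutSum f w (insert a t) = ∑ S ∈ t.powerset, w ^ #S * cutProd f t S *
      (∏ i ∈ S, f i a + w * ∏ j ∈ t \ S, f a j) := by
  rw [cutSum, sum_powerset_insert ha, ← sum_add_distrib]
  refine sum_congr rfl fun S hS => ?_
  have hS := mem_powerset.1 hS
  rw [cutProd_insert_left f ha hS, cutProd_insert_insert f ha hS,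
    card_insert_of_notMem fun h => ha (hS h)]
  ring

open Polynomial in
/-- The polynomial in `X` obtained from `cutSum` on `insert a t` by replacing `x a` by `X` and
clearing the denominators. -/
noncomputable def clearedCutSum (x : ι → ℂ) (w c : ℂ) (t : Finset ι) : ℂ[X] :=
  ∑ S ∈ t.powerset, C (w ^ #S * cutProd (pairFactor x c) t S) *
    ((∏ i ∈ S, (X ^ 2 + C (-(2 * c * x i)) * X + C (-x i ^ 2))) *
        (∏ j ∈ t \ S, (X ^ 2 + C 0 * X + C (-x j ^ 2))) +
      C w * ((∏ i ∈ S, (X ^ 2 + C 0 * X + C (-x i ^ 2))) *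
        ∏ j ∈ t \ S, (X ^ 2 + C (2 * c * x j) * X + C (-x j ^ 2))))

lemma eval_clearedCutSum (x : ι → ℂ) (w c z : ℂ) (t : Finset ι) :
    (clearedCutSum x w c t).eval z =
      ∑ S ∈ t.powerset, w ^ #S * cutProd (pairFactor x c) t S *
        ((∏ i ∈ S, (z ^ 2 - x i ^ 2 - 2 * c * x i * z)) * (∏ j ∈ t \ S, (z ^ 2 - x j ^ 2)) +
          w * ((∏ i ∈ S, (z ^ 2 - x i ^ 2)) *
            ∏ j ∈ t \ S, (z ^ 2 - x j ^ 2 + 2 * c * x j * z))) := by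
  simp only [clearedCutSum, Polynomial.eval_finsetSum, Polynomial.eval_mul, Polynomial.eval_add,
    Polynomial.eval_C, Polynomial.eval_prod, Polynomial.eval_X, Polynomial.eval_pow]
  refine sum_congr rfl fun S _ => ?_
  simp only [neg_mul, zero_mul, add_zero, ← sub_eq_add_neg]
  simp only [sub_right_comm, add_sub_right_comm]

lemma natDegree_clearedCutSum_le (x : ι → ℂ) (w c : ℂ) (t : Finset ι) :
    (clearedCutSum x w c t).natDegree ≤ 2 * #t := by
  have hquad : ∀ b d : ℂ, (Polynomial.X ^ 2 + Polynomial.C b * Polynomial.X +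
      Polynomial.C d).natDegree ≤ 2 := fun b d => by compute_degree
  have hprod : ∀ (S : Finset ι) (b d : ι → ℂ), (∏ i ∈ S, (Polynomial.X ^ 2 +
      Polynomial.C (b i) * Polynomial.X + Polynomial.C (d i))).natDegree ≤ 2 * #S := by
    intro S b d
    refine (Polynomial.natDegree_prod_le _ _).trans ?_
    refine (sum_le_card_nsmul S _ 2 fun i _ => hquad _ _).trans ?_
    simp [mul_comm]
  refine Polynomial.natDegree_sum_le_of_forall_le _ _ fun S hS => ?_
  have hcard : 2 * #S + 2 * #(t \ S) = 2 * #t := by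
    have := card_sdiff_add_card_eq_card (mem_powerset.1 hS)
    omega
  refine (Polynomial.natDegree_C_mul_le _ _).trans
    (Polynomial.natDegree_add_le_of_degree_le ?_ ?_)
  · exact hcard ▸ Polynomial.natDegree_mul_le_of_le (hprod _ _ _) (hprod _ _ _)
  · exact (Polynomial.natDegree_C_mul_le _ _).trans
      (hcard ▸ Polynomial.natDegree_mul_le_of_le (hprod _ _ _) (hprod _ _ _))

lemma eval_clearedCutSum_self {x : ι → ℂ} (w c : ℂ) {a : ι} {t : Finset ι} (ha : a ∉ t)
    (hx : ∀ i ∈ t, x i ^ 2 ≠ x a ^ 2) :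
    (clearedCutSum x w c t).eval (x a) =
      (∏ j ∈ t, (x a ^ 2 - x j ^ 2)) * cutSum (pairFactor x c) w (insert a t) := by
  rw [eval_clearedCutSum, cutSum_insert _ _ ha, mul_sum]
  refine sum_congr rfl fun S hS => ?_
  have hS := mem_powerset.1 hS
  have h1 : ∏ i ∈ S, (x a ^ 2 - x i ^ 2 - 2 * c * x i * x a) =
      (∏ i ∈ S, (x a ^ 2 - x i ^ 2)) * ∏ i ∈ S, pairFactor x c i a := by
    rw [← prod_mul_distrib]
    exact prod_congr rfl fun i hi => (pairFactor_mul_right c (hx i (hS hi))).symm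
  have h2 : ∏ j ∈ t \ S, (x a ^ 2 - x j ^ 2 + 2 * c * x j * x a) =
      (∏ j ∈ t \ S, (x a ^ 2 - x j ^ 2)) * ∏ j ∈ t \ S, pairFactor x c a j := by
    rw [← prod_mul_distrib]
    exact prod_congr rfl fun j hj =>
      (pairFactor_mul_left c (hx j (mem_sdiff.1 hj).1).symm).symm
  rw [h1, h2, ← prod_sdiff hS]
  ring

lemma eval_clearedCutSum_zero (x : ι → ℂ) (w c : ℂ) (t : Finset ι) :
    (clearedCutSum x w c t).eval 0 =
      (∏ j ∈ t, (-x j ^ 2)) * (1 + w) * cutSum (pairFactor x c) w t := by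
  rw [eval_clearedCutSum, cutSum, mul_sum]
  refine sum_congr rfl fun S hS => ?_
  rw [← prod_sdiff (mem_powerset.1 hS)]
  simp only [mul_zero, sub_zero, add_zero, ne_eq, OfNat.ofNat_ne_zero, not_false_eq_true,
    zero_pow, zero_sub]
  ring

/-- At `z = ± x b` only the residue of the pole at `x a = ± x b` survives. -/
lemma eval_clearedCutSum_of_sq_eq {x : ι → ℂ} (w c : ℂ) {z : ℂ} {b : ι} {r : Finset ι}
    (hb : b ∉ r) (hx : ∀ i ∈ r, x i ^ 2 ≠ x b ^ 2) (hz : z ^ 2 = x b ^ 2) :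
    (clearedCutSum x w c (insert b r)).eval z =
      2 * c * x b * z * w * ∑ T ∈ r.powerset, w ^ #T * cutProd (pairFactor x c) r T *
        ((∏ i ∈ T, (x b ^ 2 - x i ^ 2 - 2 * c * x i * x b)) *
            (∏ j ∈ r \ T, (x b ^ 2 - x j ^ 2 + 2 * c * x j * z)) -
          (∏ i ∈ T, (x b ^ 2 - x i ^ 2 - 2 * c * x i * z)) *
            ∏ j ∈ r \ T, (x b ^ 2 - x j ^ 2 + 2 * c * x j * x b)) := by
  rw [eval_clearedCutSum, sum_powerset_insert hb, ← sum_add_distrib, mul_sum]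
  refine sum_congr rfl fun T hT => ?_
  have hT := mem_powerset.1 hT
  have hbT : b ∉ T := fun h => hb (hT h)
  have hbrT : b ∉ r \ T := fun h => hb (mem_sdiff.1 h).1
  have hs1 : insert b r \ T = insert b (r \ T) := insert_sdiff_of_notMem _ hbT
  have hs2 : insert b r \ insert b T = r \ T := by
    ext i; simp only [mem_sdiff, mem_insert]; grind
  have h1 : ∏ i ∈ T, (x b ^ 2 - x i ^ 2 - 2 * c * x i * x b) =
      (∏ i ∈ T, (x b ^ 2 - x i ^ 2)) * ∏ i ∈ T, pairFactor x c i b := by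
    rw [← prod_mul_distrib]
    exact prod_congr rfl fun i hi => (pairFactor_mul_right c (hx i (hT hi))).symm
  have h2 : ∏ j ∈ r \ T, (x b ^ 2 - x j ^ 2 + 2 * c * x j * x b) =
      (∏ j ∈ r \ T, (x b ^ 2 - x j ^ 2)) * ∏ j ∈ r \ T, pairFactor x c b j := by
    rw [← prod_mul_distrib]
    exact prod_congr rfl fun j hj =>
      (pairFactor_mul_left c (hx j (mem_sdiff.1 hj).1).symm).symm
  rw [cutProd_insert_left _ hb hT, cutProd_insert_insert _ hb hT, hs1, hs2,
    card_insert_of_notMem hbT, h1, h2]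
  simp only [prod_insert hbT, prod_insert hbrT, hz]
  ring

lemma eval_clearedCutSum_of_eq {x : ι → ℂ} (w c : ℂ) {b : ι} {r : Finset ι}
    (hb : b ∉ r) (hx : ∀ i ∈ r, x i ^ 2 ≠ x b ^ 2) :
    (clearedCutSum x w c (insert b r)).eval (x b) = 0 := by
  simp [eval_clearedCutSum_of_sq_eq w c hb hx rfl]

lemma eval_clearedCutSum_of_eq_neg {x : ι → ℂ} (w c : ℂ) {b : ι} {r : Finset ι}
    (hb : b ∉ r) (hx : ∀ i ∈ r, x i ^ 2 ≠ x b ^ 2) :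
    (clearedCutSum x w c (insert b r)).eval (-x b) =
      2 * c * x b ^ 2 * w * cutSum (pairFactor x c) w r *
        (∏ i ∈ r, (x b ^ 2 - x i ^ 2 + 2 * c * x i * x b) -
          ∏ i ∈ r, (x b ^ 2 - x i ^ 2 - 2 * c * x i * x b)) := by
  rw [eval_clearedCutSum_of_sq_eq w c hb hx (neg_sq _), cutSum, mul_sum, mul_sum, sum_mul]
  refine sum_congr rfl fun T hT => ?_
  rw [← prod_sdiff (mem_powerset.1 hT), ← prod_sdiff (mem_powerset.1 hT)]
  simp only [mul_neg, sub_neg_eq_add, ← sub_eq_add_neg]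
  ring

/-- `cutSum` of the two-body factors is even in the coupling `c`. -/
theorem cutSum_pairFactor_neg {x : ι → ℂ} (w c : ℂ) (s : Finset ι) (h0 : ∀ i ∈ s, x i ≠ 0)
    (hx : ∀ i ∈ s, ∀ j ∈ s, i ≠ j → x i ^ 2 ≠ x j ^ 2) :
    cutSum (pairFactor x (-c)) w s = cutSum (pairFactor x c) w s := by
  induction s using Finset.strongInduction with
  | H s ih =>
  rcases s.eq_empty_or_nonempty with rfl | ⟨a, ha⟩
  · simp [cutSum, cutProd]
  obtain ⟨t, hat, rfl⟩ : ∃ t, a ∉ t ∧ insert a t = s :=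
    ⟨s.erase a, notMem_erase a s, insert_erase ha⟩
  have hsub : ∀ r ⊆ t, cutSum (pairFactor x (-c)) w r = cutSum (pairFactor x c) w r := by
    intro r hr
    have hr' : r ⊆ insert a t := hr.trans (subset_insert a t)
    refine ih r ⟨hr', fun h => hat (hr (h (mem_insert_self a t)))⟩
      (fun i hi => h0 i (hr' hi)) fun i hi j hj => hx i (hr' hi) j (hr' hj)
  have hta : ∀ i ∈ t, x i ^ 2 ≠ x a ^ 2 := fun i hi =>
    hx i (mem_insert_of_mem hi) a (mem_insert_self a t) fun h => hat (h ▸ hi)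
  have ht0 : ∀ i ∈ t, x i ≠ 0 := fun i hi => h0 i (mem_insert_of_mem hi)
  have htt : ∀ i ∈ t, ∀ j ∈ t, x i ^ 2 = x j ^ 2 → i = j := fun i hi j hj h =>
    by_contra fun hij => hx i (mem_insert_of_mem hi) j (mem_insert_of_mem hj) hij h
  have heval : ∀ b ∈ t, ∀ z, z = x b ∨ z = -x b →
      (clearedCutSum x w (-c) t).eval z = (clearedCutSum x w c t).eval z := by
    intro b hb z hz
    obtain ⟨r, hbr, rfl⟩ : ∃ r, b ∉ r ∧ insert b r = t :=
      ⟨t.erase b, notMem_erase b t, insert_erase hb⟩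
    have hrb : ∀ i ∈ r, x i ^ 2 ≠ x b ^ 2 := fun i hi h =>
      hbr (htt i (mem_insert_of_mem hi) b (mem_insert_self b r) h ▸ hi)
    rcases hz with rfl | rfl
    · rw [eval_clearedCutSum_of_eq w _ hbr hrb, eval_clearedCutSum_of_eq w _ hbr hrb]
    · rw [eval_clearedCutSum_of_eq_neg w _ hbr hrb, eval_clearedCutSum_of_eq_neg w _ hbr hrb,
        hsub r (subset_insert b r)]
      simp only [mul_neg, neg_mul, sub_neg_eq_add, ← sub_eq_add_neg]
      ring
  have hinj : Set.InjOn x t := fun i hi j hj h => htt i hi j hj (by rw [h])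
  have hinj' : Set.InjOn (fun i => -x i) t := fun i hi j hj h => hinj hi hj (neg_injective h)
  have hdisj : Disjoint (t.image x) (t.image fun i => -x i) := by
    rw [disjoint_left]
    intro z hz hz'
    obtain ⟨i, hi, rfl⟩ := mem_image.1 hz
    obtain ⟨j, hj, hij⟩ := mem_image.1 hz'
    have hij' : j = i := htt j hj i hi (by rw [← hij]; ring)
    subst hij'
    exact ht0 j hj (by linear_combination (-1 / 2 : ℂ) * hij)
  have hzero : (0 : ℂ) ∉ t.image x ∪ t.image fun i => -x i := by
    simp only [mem_union, mem_image, neg_eq_zero, or_self]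
    rintro ⟨i, hi, h⟩
    exact ht0 i hi h
  have hpoly : clearedCutSum x w (-c) t - clearedCutSum x w c t = 0 := by
    refine Polynomial.eq_zero_of_natDegree_lt_card_of_eval_eq_zero' _
      (insert 0 (t.image x ∪ t.image fun i => -x i)) (fun z hz => ?_) ?_
    · rw [Polynomial.eval_sub, sub_eq_zero]
      simp only [mem_insert, mem_union, mem_image] at hz
      rcases hz with rfl | ⟨i, hi, rfl⟩ | ⟨i, hi, rfl⟩
      · rw [eval_clearedCutSum_zero, eval_clearedCutSum_zero, hsub t Subset.rfl]
      · exact heval i hi _ (Or.inl rfl)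
      · exact heval i hi _ (Or.inr rfl)
    · rw [card_insert_of_notMem hzero, card_union_of_disjoint hdisj, card_image_of_injOn hinj,
        card_image_of_injOn hinj']
      have := Polynomial.natDegree_sub_le_of_le (natDegree_clearedCutSum_le x w (-c) t)
        (natDegree_clearedCutSum_le x w c t)
      omega
  have hself := congrArg (Polynomial.eval (x a)) (sub_eq_zero.1 hpoly)
  rw [eval_clearedCutSum_self w _ hat hta, eval_clearedCutSum_self w _ hat hta] at hself
  exact mul_left_cancel₀ (prod_ne_zero_iff.2 fun j hj => sub_ne_zero.2 (hta j hj).symm) hself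

end BipartitionSum

lemma prod_prod_ite_lt_mul {n : ℕ} (g : Fin n → Fin n → ℂ) (hg : ∀ i, g i i = 1) :
    (∏ i : Fin n, ∏ j : Fin n, if (i : ℕ) < (j : ℕ) then g i j * g j i else 1) = ∏ i, ∏ j, g i j := by
  have h : ∀ i j : Fin n, (if (i : ℕ) < (j : ℕ) then g i j * g j i else 1) =
      (if i < j then g i j else 1) * (if i < j then g j i else 1) := by
    intro i j
    by_cases hij : i < j <;> simp [hij]
  simp only [h, prod_mul_distrib]
  rw [prod_comm (f := fun i j => if i < j then g j i else 1)]
  simp only [← prod_mul_distrib]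
  refine prod_congr rfl fun i _ => prod_congr rfl fun j _ => ?_
  rcases lt_trichotomy i j with hij | rfl | hij
  · simp [hij, hij.not_gt]
  · simp [hg]
  · simp [hij, hij.not_gt]

lemma div_sinh_sub (c a b : ℂ) :
    c / Complex.sinh (a - b) =
      c * (2 * Complex.exp a * Complex.exp b / (Complex.exp a ^ 2 - Complex.exp b ^ 2)) := by
  have ha := Complex.exp_ne_zero a
  have hb := Complex.exp_ne_zero b
  have h : Complex.sinh (a - b) =
      (Complex.exp a ^ 2 - Complex.exp b ^ 2) / (2 * Complex.exp a * Complex.exp b) := by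
    rw [Complex.sinh, neg_sub, Complex.exp_sub, Complex.exp_sub]
    field_simp
  rw [h, div_div_eq_mul_div, mul_div_assoc]

lemma Kfun_pq_eq_cutSum (ν : ℝ) {n : ℕ} {q : ℂ} (hq : q ≠ 0) (θ : Fin n → ℂ) :
    Kfun ν (pq q) θ = q ^ n * cutSum (pairFactor (fun i => Complex.exp (θ i))
      (Complex.I * (Real.sin (Real.pi * ν) : ℂ))) (-(q ^ 2)⁻¹) univ := by
  set c : ℂ := Complex.I * (Real.sin (Real.pi * ν) : ℂ) with hc
  rw [Kfun, cutSum, mul_sum]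
  refine sum_bij' (fun l _ => univ.filter fun i => l i = 1)
    (fun S _ i => if i ∈ S then 1 else 0) (by simp) (by simp) ?_ ?_ ?_
  · intro l _
    funext i
    have : l i = 0 ∨ l i = 1 := by omega
    rcases this with h | h <;> simp [h]
  · intro S _
    ext i
    simp
  · intro l _
    have hprod : (∏ i : Fin n, ∏ j : Fin n, if (i : ℕ) < (j : ℕ) then
        1 + (((l i : ℕ) : ℂ) - ((l j : ℕ) : ℂ)) * Complex.I *
          (Real.sin (Real.pi * ν) : ℂ) / Complex.sinh (θ i - θ j) else 1) =
        cutProd (pairFactor (fun i => Complex.exp (θ i)) c) univ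
          (univ.filter fun i => l i = 1) := by
      rw [cutProd, prod_filter]
      have hsd : univ \ univ.filter (fun i => l i = 1) = univ.filter fun i => ¬ l i = 1 := by
        ext i; simp
      rw [hsd]
      simp only [prod_filter]
      trans ∏ i : Fin n, ∏ j : Fin n, if l i = 1 ∧ ¬ l j = 1 then
        pairFactor (fun i => Complex.exp (θ i)) c i j else 1
      · rw [← prod_prod_ite_lt_mul (fun i j => if l i = 1 ∧ ¬ l j = 1 then
          pairFactor (fun i => Complex.exp (θ i)) c i j else 1) (by simp)]
        refine prod_congr rfl fun i _ => prod_congr rfl fun j _ => ?_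
        have hneg : Complex.sinh (θ i - θ j) = -Complex.sinh (θ j - θ i) := by
          rw [← Complex.sinh_neg, neg_sub]
        have hi : l i = 0 ∨ l i = 1 := by omega
        have hj : l j = 0 ∨ l j = 1 := by omega
        congr 1
        rcases hi with hi | hi <;> rcases hj with hj | hj <;>
          simp [hi, hj, pairFactor, ← div_sinh_sub, hc, hneg, neg_div, div_neg]
      · refine prod_congr rfl fun i _ => ?_
        by_cases hi : l i = 1 <;> simp [hi]
    have hweight : (-1 : ℂ) ^ (∑ i, (l i : ℕ)) * pq q θ l =
        q ^ n * (-(q ^ 2)⁻¹) ^ #(univ.filter fun i => l i = 1) := by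
      have hn : q ^ n = ∏ _i : Fin n, q := by simp
      rw [pq, ← prod_pow_eq_pow_sum, ← prod_const, prod_filter, hn, ← prod_mul_distrib,
        ← prod_mul_distrib]
      refine prod_congr rfl fun i _ => ?_
      have hi : l i = 0 ∨ l i = 1 := by omega
      rcases hi with hi | hi
      · simp [hi]
      · simp [hi]
        field_simp
    rw [hprod, mul_right_comm, hweight, mul_assoc]

lemma Kfun_pq_inv (ν : ℝ) {n : ℕ} (q : ℂ) (θ : Fin n → ℂ) :
    Kfun ν (pq q⁻¹) θ = (-1 : ℂ) ^ n * Kfun (-ν) (pq q) θ := by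
  rw [Kfun, Kfun, mul_sum,
    ← Equiv.sum_comp (Equiv.piCongrRight fun _ : Fin n => (Fin.revPerm : Equiv.Perm (Fin 2)))]
  refine sum_congr rfl fun l _ => ?_
  have hl : ∀ i, l i = 0 ∨ l i = 1 := fun i => by omega
  have hsign : (-1 : ℂ) ^ (∑ i, ((Fin.rev (l i) : Fin 2) : ℕ)) =
      (-1 : ℂ) ^ n * (-1 : ℂ) ^ (∑ i, (l i : ℕ)) := by
    have hn : (-1 : ℂ) ^ n = ∏ _i : Fin n, (-1 : ℂ) := by simp
    rw [← prod_pow_eq_pow_sum, ← prod_pow_eq_pow_sum, hn, ← prod_mul_distrib]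
    refine prod_congr rfl fun i _ => ?_
    rcases hl i with h | h <;> simp [h, Fin.rev]
  have hpq : pq q⁻¹ θ (fun i => Fin.rev (l i)) = pq q θ l := by
    refine prod_congr rfl fun i _ => ?_
    rcases hl i with h | h <;> simp [h, Fin.rev]
  change (-1 : ℂ) ^ (∑ i, ((Fin.rev (l i) : Fin 2) : ℕ)) * _ *
    pq q⁻¹ θ (fun i => Fin.rev (l i)) = _
  rw [hsign, hpq, mul_assoc, mul_assoc, mul_assoc]
  congr 3
  refine prod_congr rfl fun i _ => prod_congr rfl fun j _ => ?_
  congr 1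
  rcases hl i with hi | hi <;> rcases hl j with hj | hj <;> simp [hi, hj, Fin.rev]

/-- Lemma 2, first identity: `K̃_n^{(1/q)}(θ) = (−1)^n K̃_n^{(q)}(θ)`. -/
theorem Ktilde_q_inv (ν : ℝ) (n : ℕ) (hn : 1 ≤ n) (q : ℂ) (hq : q ≠ 0)
    (θ : Fin n → ℂ) (hθ : Admissible θ) :
    Kfun ν (pq q⁻¹) θ = (-1 : ℂ) ^ n * Kfun ν (pq q) θ := by
  rw [Kfun_pq_inv, Kfun_pq_eq_cutSum _ hq, Kfun_pq_eq_cutSum _ hq]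
  have hne : ∀ i j : Fin n, i ≠ j → Complex.sinh (θ i - θ j) ≠ 0 := by
    intro i j hij
    rcases lt_or_gt_of_ne hij with h | h
    · exact hθ i j h
    · rw [← neg_sub, Complex.sinh_neg]
      exact neg_ne_zero.2 (hθ j i h)
  have hneg : Complex.I * (Real.sin (Real.pi * -ν) : ℂ) =
      -(Complex.I * (Real.sin (Real.pi * ν) : ℂ)) := by
    rw [mul_neg, Real.sin_neg, Complex.ofReal_neg, mul_neg]
  rw [hneg, cutSum_pairFactor_neg _ _ _ fun i _ => Complex.exp_ne_zero (θ i)]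
  intro i _ j _ hij h
  have h1 := div_sinh_sub 1 (θ i) (θ j)
  rw [h, sub_self, div_zero, mul_zero] at h1
  exact one_div_ne_zero (hne i j hij) h1
end
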